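/- Let l : ℝⁿ → ℝ be differentiable with l(0) = 0, c_m-restricted strongly concave and C̃_1-restricted smooth on the nonnegative orthant, let m ≥ 1, and assume an L-maximizer ζ^(L) of l exists for every finite L (write f(L) = l(ζ^(L))). Let p ∈ {1,…,n} satisfy ∇_p l(0) ≥ ∇_j l(0) for all j. If c_m / C̃_1 ≤ 1/m, then for every set T ⊆ {1,…,n} with |T| ≤ m one has f({p}) ≥ (c_m² / C̃_1²) · f(T). -/

import Mathlib

open Finset

/-- componentwise nonnegativity -/
def Nonneg {n : ℕ} (x : Fin n → ℝ) : Prop := ∀ i, 0 ≤ x i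

/-- the j-th partial derivative of l at x -/
noncomputable def pgrad {n : ℕ} (l : (Fin n → ℝ) → ℝ) (x : Fin n → ℝ) (j : Fin n) : ℝ :=
  fderiv ℝ l x (Pi.single j 1)

/-- `l` is `C`-restricted smooth (RSM) at sparsity level `k` on the nonnegative orthant -/
def RSM {n : ℕ} (l : (Fin n → ℝ) → ℝ) (k : ℕ) (C : ℝ) : Prop :=
  ∀ x y : Fin n → ℝ, Nonneg x → Nonneg y → {i | y i - x i ≠ 0}.ncard ≤ k →
    l y - l x - fderiv ℝ l x (y - x) ≥ -(C / 2) * ∑ i, (y i - x i) ^ 2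

/-- `l` is `c`-restricted strongly concave (RSC) at sparsity level `k`
on the nonnegative orthant -/
def RSC {n : ℕ} (l : (Fin n → ℝ) → ℝ) (k : ℕ) (c : ℝ) : Prop :=
  ∀ x y : Fin n → ℝ, Nonneg x → Nonneg y →
    {i | x i ≠ 0}.ncard ≤ k → {i | y i ≠ 0}.ncard ≤ k →
    l y - l x - fderiv ℝ l x (y - x) ≤ -(c / 2) * ∑ i, (y i - x i) ^ 2

/-- `ζ` is an `L`-maximizer of `l`: nonnegative, supported in `L`, and maximal among
such points -/
def IsMaximizerOn {n : ℕ} (l : (Fin n → ℝ) → ℝ) (L : Finset (Fin n)) (ζ : Fin n → ℝ) : Prop :=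
  Nonneg ζ ∧ (∀ i, ζ i ≠ 0 → i ∈ L) ∧
    ∀ w : Fin n → ℝ, Nonneg w → (∀ i, w i ≠ 0 → i ∈ L) → l w ≤ l ζ

/-- the derivative of `l` is the sum of its partial derivatives weighted by the coordinates -/
lemma fderiv_eq_sum_pgrad {n : ℕ} (l : (Fin n → ℝ) → ℝ) (x v : Fin n → ℝ) :
    fderiv ℝ l x v = ∑ i, v i * pgrad l x i := by
  conv_lhs => rw [pi_eq_sum_univ' v]
  simp [pgrad, map_sum]

/-- a maximizer over a set containing `p` beats a single ascent step along coordinate `p` -/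
lemma sq_div_le_of_isMaximizerOn {n : ℕ} {l : (Fin n → ℝ) → ℝ} {C : ℝ} (hC : 0 < C)
    (hl0 : l 0 = 0) (h : RSM l 1 C) {L : Finset (Fin n)} {ζ : Fin n → ℝ}
    (hζ : IsMaximizerOn l L ζ) {p : Fin n} (hpL : p ∈ L) :
    max (pgrad l 0 p) 0 ^ 2 / (2 * C) ≤ l ζ := by
  set t := max (pgrad l 0 p) 0 with ht
  have ht0 : 0 ≤ t := le_max_right _ _
  have htt : t * pgrad l 0 p = t ^ 2 := by
    rcases max_choice (pgrad l 0 p) 0 with h' | h' <;> rw [ht, h'] <;> ring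
  set y : Fin n → ℝ := Pi.single p (t / C) with hy
  have hsupp : ∀ i, y i ≠ 0 → i = p := fun i hi => by
    by_contra hip
    exact hi (by simp [hy, hip])
  have hynn : Nonneg y := fun i => by
    by_cases hip : i = p
    · subst hip
      simpa [hy] using div_nonneg ht0 hC.le
    · simp [hy, hip]
  have hcard : {i | y i - (0 : Fin n → ℝ) i ≠ 0}.ncard ≤ 1 := by
    rw [← Set.ncard_singleton p]
    exact Set.ncard_le_ncard fun i hi => hsupp i (by simpa using hi)
  have hstep := h 0 y (fun _ => le_rfl) hynn hcard
  have hlin : fderiv ℝ l 0 (y - 0) = t / C * pgrad l 0 p := by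
    rw [sub_zero, fderiv_eq_sum_pgrad, Finset.sum_eq_single p] <;> simp +contextual [hy]
  have hquad : ∑ i, (y i - (0 : Fin n → ℝ) i) ^ 2 = (t / C) ^ 2 := by
    rw [Finset.sum_eq_single p] <;> simp +contextual [hy]
  have hval : t / C * pgrad l 0 p - C / 2 * (t / C) ^ 2 = t ^ 2 / (2 * C) := by
    rw [div_mul_eq_mul_div, htt]
    field_simp
    ring
  have hmax := hζ.2.2 y hynn fun i hi => hsupp i hi ▸ hpL
  rw [hlin, hquad, hl0] at hstep
  linarith

/-- restricted strong concavity bounds `l` at sparse points by its gradient at `0` -/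
lemma le_card_mul_sq_div_of_RSC {n m : ℕ} {l : (Fin n → ℝ) → ℝ} {c t : ℝ} (hc : 0 < c)
    (hl0 : l 0 = 0) (h : RSC l m c) (ht : ∀ j, pgrad l 0 j ≤ t)
    {T : Finset (Fin n)} (hT : T.card ≤ m) {x : Fin n → ℝ} (hx : Nonneg x)
    (hxT : ∀ i, x i ≠ 0 → i ∈ T) :
    l x ≤ T.card * (t ^ 2 / (2 * c)) := by
  have hcard : {i | x i ≠ 0}.ncard ≤ m := by
    refine le_trans ?_ hT
    rw [← Set.ncard_coe_finset T]
    exact Set.ncard_le_ncard fun i hi => hxT i hi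
  have hconc := h 0 x (fun _ => le_rfl) hx (by simp) hcard
  rw [hl0, sub_zero, sub_zero, fderiv_eq_sum_pgrad] at hconc
  simp only [Pi.zero_apply, sub_zero] at hconc
  calc l x ≤ ∑ i, (x i * pgrad l 0 i - c / 2 * x i ^ 2) := by
        rw [Finset.sum_sub_distrib, ← Finset.mul_sum]
        linarith
    _ = ∑ i ∈ T, (x i * pgrad l 0 i - c / 2 * x i ^ 2) := by
        refine (Finset.sum_subset (Finset.subset_univ T) fun i _ hi => ?_).symm
        have : x i = 0 := by
          by_contra hne
          exact hi (hxT i hne)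
        simp [this]
    _ ≤ ∑ _i ∈ T, t ^ 2 / (2 * c) := by
        refine Finset.sum_le_sum fun i _ => ?_
        have hlin := mul_le_mul_of_nonneg_left (ht i) (hx i)
        rw [le_div_iff₀ (by positivity)]
        nlinarith [sq_nonneg (t - c * x i)]
    _ = T.card * (t ^ 2 / (2 * c)) := by simp

/-- Few-prototypes case: when `c_m/C̃₁ ≤ 1/m`, the singleton set `{p}` with the
largest gradient at 0 already gives a constant factor approximation. -/
theorem singleton_constant_factor {n m : ℕ} (l : (Fin n → ℝ) → ℝ)
    (hl : Differentiable ℝ l) (hl0 : l 0 = 0)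
    (cm C1 : ℝ) (hcm : 0 < cm) (hC1 : 0 < C1)
    (hRSC : RSC l m cm) (hRSM : RSM l 1 C1)
    (hm : 1 ≤ m)
    (ζ : Finset (Fin n) → (Fin n → ℝ)) (hζ : ∀ L, IsMaximizerOn l L (ζ L))
    (p : Fin n) (hp : ∀ j, pgrad l 0 j ≤ pgrad l 0 p)
    (hκ : cm / C1 ≤ 1 / m) :
    ∀ T : Finset (Fin n), T.card ≤ m →
      l (ζ {p}) ≥ (cm ^ 2 / C1 ^ 2) * l (ζ T) := by
  intro T hT
  have hmaxT := hζ T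
  have hlow := sq_div_le_of_isMaximizerOn hC1 hl0 hRSM (hζ {p}) (Finset.mem_singleton_self p)
  have hup := le_card_mul_sq_div_of_RSC hcm hl0 hRSC (fun j => (hp j).trans (le_max_left _ 0)) hT
    hmaxT.1 hmaxT.2.1
  set t := max (pgrad l 0 p) 0
  have hm0 : (0 : ℝ) < m := by exact_mod_cast hm
  have hκ' : cm / C1 * m ≤ 1 := (le_div_iff₀ hm0).1 hκ
  calc cm ^ 2 / C1 ^ 2 * l (ζ T) ≤ cm ^ 2 / C1 ^ 2 * (m * (t ^ 2 / (2 * cm))) := by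
        refine mul_le_mul_of_nonneg_left (hup.trans ?_) (by positivity)
        gcongr
    _ = cm / C1 * m * (t ^ 2 / (2 * C1)) := by field_simp
    _ ≤ 1 * (t ^ 2 / (2 * C1)) := mul_le_mul_of_nonneg_right hκ' (by positivity)
    _ ≤ l (ζ {p}) := by rwa [one_mul]
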